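/- arXiv:2208.03119 — 6 statements merged into one kernel-verified Lean document; each statement's English description precedes it below -/
import Mathlib

section
/- Let g: ℝⁿ → ℝ^{n_c} be continuously differentiable with Jacobian G(x) = ∂g/∂x, let α > 0, and let x: ℝ → ℝⁿ be differentiable. Suppose Γ: ℝ → ℝ^{n×(n−n_c)} and Γ̌: ℝ → ℝ^{n×n_c} are (continuous) matrix-valued functions satisfying, for every t, G(x(t))Γ(t) = 0 and G(x(t))Γ̌(t) = I, and suppose e: ℝ → ℝ^{n−n_c} is continuous with ẋ(t) = Γ(t)e(t) − αΓ̌(t)g(x(t)) for all t. If g(x(0)) = 0, then g(x(t)) = 0 for all t ∈ ℝ. -/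
open Matrix

/-- A curve whose derivative is `-α` times itself and which vanishes at `0` vanishes identically. -/
theorem eq_zero_of_hasDerivAt_neg_smul {E : Type*} [NormedAddCommGroup E] [NormedSpace ℝ E]
    {α : ℝ} {h : ℝ → E} (hh : ∀ t, HasDerivAt h (-(α • h t)) t) (h0 : h 0 = 0) (t : ℝ) :
    h t = 0 := by
  have key : ∀ s, HasDerivAt (fun s => Real.exp (α * s) • h s) 0 s := by
    intro s
    have hexp : HasDerivAt (fun s => Real.exp (α * s)) (Real.exp (α * s) * α) s := by
      simpa using ((hasDerivAt_id s).const_mul α).exp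
    refine (hexp.smul (hh s)).congr_deriv ?_
    rw [smul_neg, smul_smul, neg_add_cancel]
  have hconst := is_const_of_deriv_eq_zero (fun s => (key s).differentiableAt)
    (fun s => (key s).deriv) t 0
  simpa [h0, Real.exp_ne_zero] using hconst

/-- Baumgarte-type constraint stabilization: if GΓ = 0, GΓ̌ = I
along the motion and ẋ = Γe − αΓ̌g(x) with α > 0, then g(x(0)) = 0 implies
g(x(t)) = 0 for all t. -/
theorem constraint_preserved {n nc : ℕ} (hnc : 0 < nc) (hn : nc < n)
    (g : (Fin n → ℝ) → (Fin nc → ℝ))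
    (G : (Fin n → ℝ) → Matrix (Fin nc) (Fin n) ℝ)
    (hg : ∀ x₀ : Fin n → ℝ,
      HasFDerivAt g (LinearMap.toContinuousLinearMap (G x₀).mulVecLin) x₀)
    (α : ℝ) (hα : 0 < α)
    (x x' : ℝ → Fin n → ℝ)
    (hx : ∀ t, HasDerivAt x (x' t) t)
    (Γ : ℝ → Matrix (Fin n) (Fin (n - nc)) ℝ)
    (Γc : ℝ → Matrix (Fin n) (Fin nc) ℝ)
    (hΓcont : ∀ i j, Continuous fun t => Γ t i j)
    (hΓccont : ∀ i j, Continuous fun t => Γc t i j)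
    (hGΓ : ∀ t, G (x t) * Γ t = 0)
    (hGΓc : ∀ t, G (x t) * Γc t = 1)
    (e : ℝ → Fin (n - nc) → ℝ) (he : Continuous e)
    (hkin : ∀ t, x' t = Γ t *ᵥ e t - α • (Γc t *ᵥ g (x t)))
    (h0 : g (x 0) = 0) :
    ∀ t, g (x t) = 0 := by
  refine eq_zero_of_hasDerivAt_neg_smul (α := α) (h := fun t => g (x t)) (fun t => ?_) h0
  refine ((hg (x t)).comp_hasDerivAt t (hx t)).congr_deriv ?_
  simp [hkin t, mulVec_sub, mulVec_smul, mulVec_mulVec, hGΓ t, hGΓc t]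
end

section
/- Let M, C, K ∈ ℝ^{n×n}, let G₀ ∈ ℝ^{n_c×n} have full row rank n_c, and let Γ₀ ∈ ℝ^{n×(n−n_c)} have full column rank n−n_c with G₀Γ₀ = 0; regard all matrices as complex matrices. For every λ ∈ ℂ the following are equivalent: (i) there exist x̂ ∈ ℂⁿ with x̂ ≠ 0 and μ̂ ∈ ℂ^{n_c} such that λ²Mx̂ + λCx̂ + Kx̂ + G₀ᵀμ̂ = 0 and G₀x̂ = 0; (ii) there exists x̃ ∈ ℂ^{n−n_c} with x̃ ≠ 0 such that (λ²Γ₀ᵀMΓ₀ + λΓ₀ᵀCΓ₀ + Γ₀ᵀKΓ₀)x̃ = 0. Moreover, in (i) one can take x̂ = Γ₀x̃, and μ̂ is then uniquely determined. -/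
open Matrix

/-- A real matrix of full column rank has an invertible Gram matrix. -/
theorem isUnit_transpose_mul_self_of_rank {m k : Type*} [Fintype m] [Fintype k] [DecidableEq k]
    (A : Matrix m k ℝ) (hA : A.rank = Fintype.card k) : IsUnit (Aᵀ * A) := by
  rw [← mulVec_injective_iff_isUnit, mulVec_injective_iff, linearIndependent_iff_card_eq_finrank_span,
    Set.finrank, ← rank_eq_finrank_span_cols, rank_transpose_mul_self, hA]

/-- If `G` has full row rank and the columns of `Γ` form a basis of its kernel, then `G` has a
right inverse `R` and `Γ` a left inverse `L` such that `R * G` and `Γ * L` are complementary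
projections. -/
theorem exists_complementary_inverses {c m k : Type*} [Fintype c] [Fintype m] [Fintype k]
    [DecidableEq c] [DecidableEq m] [DecidableEq k] (G : Matrix c m ℝ) (Γ : Matrix m k ℝ)
    (hG : G.rank = Fintype.card c) (hΓ : Γ.rank = Fintype.card k) (hGΓ : G * Γ = 0)
    (hcard : Fintype.card c + Fintype.card k = Fintype.card m) :
    ∃ (R : Matrix m c ℝ) (L : Matrix k m ℝ), G * R = 1 ∧ L * Γ = 1 ∧ R * G + Γ * L = 1 := by
  have hGG : IsUnit (G * Gᵀ) := by
    simpa using isUnit_transpose_mul_self_of_rank Gᵀ (by rw [rank_transpose, hG])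
  have hΓΓ := isUnit_transpose_mul_self_of_rank Γ hΓ
  have hΓG : Γᵀ * Gᵀ = 0 := by rw [← transpose_mul, hGΓ, transpose_zero]
  have hR : G * (Gᵀ * (G * Gᵀ)⁻¹) = 1 := by
    rw [← Matrix.mul_assoc, mul_nonsing_inv _ ((isUnit_iff_isUnit_det _).1 hGG)]
  have hL : (Γᵀ * Γ)⁻¹ * Γᵀ * Γ = 1 := by
    rw [Matrix.mul_assoc, nonsing_inv_mul _ ((isUnit_iff_isUnit_det _).1 hΓΓ)]
  have hLR : (Γᵀ * Γ)⁻¹ * Γᵀ * (Gᵀ * (G * Gᵀ)⁻¹) = 0 := by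
    rw [Matrix.mul_assoc, ← Matrix.mul_assoc Γᵀ, hΓG, Matrix.zero_mul, Matrix.mul_zero]
  refine ⟨Gᵀ * (G * Gᵀ)⁻¹, (Γᵀ * Γ)⁻¹ * Γᵀ, hR, hL, ?_⟩
  rw [← fromCols_mul_fromRows,
    fromCols_mul_fromRows_eq_one_comm (Fintype.equivOfCardEq (by simp [hcard])),
    fromRows_mul_fromCols, hR, hL, hLR, hGΓ, fromBlocks_one]

/-- Equivalence between the finite-magnitude eigenvalue problem of
the linearized constrained DAE system (with nonzero displacement component) and
the reduced quadratic eigenvalue problem projected onto the constraint kernel;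
moreover one can take x̂ = Γ₀x̃ and μ̂ is then uniquely determined. -/
theorem dae_reduced_spectrum_equivalence {n nc : ℕ} (hnc : 0 < nc) (hn : nc < n)
    (M Cd K : Matrix (Fin n) (Fin n) ℝ)
    (G₀ : Matrix (Fin nc) (Fin n) ℝ) (Γ₀ : Matrix (Fin n) (Fin (n - nc)) ℝ)
    (hG : G₀.rank = nc) (hΓ : Γ₀.rank = n - nc) (hGΓ : G₀ * Γ₀ = 0) :
    ∀ lam : ℂ,
      ((∃ xh : Fin n → ℂ, xh ≠ 0 ∧ ∃ μh : Fin nc → ℂ,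
          lam ^ 2 • (M.map Complex.ofReal *ᵥ xh)
            + lam • (Cd.map Complex.ofReal *ᵥ xh)
            + K.map Complex.ofReal *ᵥ xh
            + (G₀ᵀ).map Complex.ofReal *ᵥ μh = 0 ∧
          G₀.map Complex.ofReal *ᵥ xh = 0) ↔
        (∃ xt : Fin (n - nc) → ℂ, xt ≠ 0 ∧
          lam ^ 2 • ((Γ₀ᵀ * M * Γ₀).map Complex.ofReal *ᵥ xt)
            + lam • ((Γ₀ᵀ * Cd * Γ₀).map Complex.ofReal *ᵥ xt)
            + (Γ₀ᵀ * K * Γ₀).map Complex.ofReal *ᵥ xt = 0)) ∧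
      (∀ xt : Fin (n - nc) → ℂ,
          lam ^ 2 • ((Γ₀ᵀ * M * Γ₀).map Complex.ofReal *ᵥ xt)
            + lam • ((Γ₀ᵀ * Cd * Γ₀).map Complex.ofReal *ᵥ xt)
            + (Γ₀ᵀ * K * Γ₀).map Complex.ofReal *ᵥ xt = 0 →
        ∃! μh : Fin nc → ℂ,
          lam ^ 2 • (M.map Complex.ofReal *ᵥ (Γ₀.map Complex.ofReal *ᵥ xt))
            + lam • (Cd.map Complex.ofReal *ᵥ (Γ₀.map Complex.ofReal *ᵥ xt))
            + K.map Complex.ofReal *ᵥ (Γ₀.map Complex.ofReal *ᵥ xt)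
            + (G₀ᵀ).map Complex.ofReal *ᵥ μh = 0) := by
  intro lam
  obtain ⟨R, L, hR, hL, hRL⟩ := exists_complementary_inverses G₀ Γ₀ (by simpa using hG)
    (by simpa using hΓ) hGΓ (by simp; omega)
  have hφ {a b d : ℕ} (A : Matrix (Fin a) (Fin b) ℝ) (B : Matrix (Fin b) (Fin d) ℝ) :
      (A * B).map Complex.ofReal = A.map Complex.ofReal * B.map Complex.ofReal :=
    Matrix.map_mul (f := Complex.ofRealHom)
  have hone {a : ℕ} : (1 : Matrix (Fin a) (Fin a) ℝ).map Complex.ofReal = 1 :=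
    Matrix.map_one _ Complex.ofReal_zero Complex.ofReal_one
  have hΓG : (Γ₀ᵀ).map Complex.ofReal * (G₀ᵀ).map Complex.ofReal = 0 := by
    rw [← hφ, ← transpose_mul, hGΓ, transpose_zero, Matrix.map_zero _ Complex.ofReal_zero]
  have hGΓ' : G₀.map Complex.ofReal * Γ₀.map Complex.ofReal = 0 := by
    rw [← hφ, hGΓ, Matrix.map_zero _ Complex.ofReal_zero]
  have hRG : (Rᵀ).map Complex.ofReal * (G₀ᵀ).map Complex.ofReal = 1 := by
    rw [← hφ, ← transpose_mul, hR, transpose_one, hone]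
  have hLΓ : L.map Complex.ofReal * Γ₀.map Complex.ofReal = 1 := by rw [← hφ, hL, hone]
  have hsplit : R.map Complex.ofReal * G₀.map Complex.ofReal
      + Γ₀.map Complex.ofReal * L.map Complex.ofReal = 1 := by
    rw [← hφ, ← hφ, ← Matrix.map_add _ Complex.ofReal_add, hRL, hone]
  have hsplitT : (G₀ᵀ).map Complex.ofReal * (Rᵀ).map Complex.ofReal
      + (Lᵀ).map Complex.ofReal * (Γ₀ᵀ).map Complex.ofReal = 1 := by
    rw [← hφ, ← hφ, ← Matrix.map_add _ Complex.ofReal_add, ← transpose_mul, ← transpose_mul,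
      ← transpose_add, hRL, transpose_one, hone]
  have hred (xt : Fin (n - nc) → ℂ) :
      lam ^ 2 • ((Γ₀ᵀ * M * Γ₀).map Complex.ofReal *ᵥ xt)
        + lam • ((Γ₀ᵀ * Cd * Γ₀).map Complex.ofReal *ᵥ xt)
        + (Γ₀ᵀ * K * Γ₀).map Complex.ofReal *ᵥ xt
      = (Γ₀ᵀ).map Complex.ofReal *ᵥ
        (lam ^ 2 • (M.map Complex.ofReal *ᵥ (Γ₀.map Complex.ofReal *ᵥ xt))
          + lam • (Cd.map Complex.ofReal *ᵥ (Γ₀.map Complex.ofReal *ᵥ xt))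
          + K.map Complex.ofReal *ᵥ (Γ₀.map Complex.ofReal *ᵥ xt)) := by
    simp only [hφ, mulVec_add, mulVec_smul, mulVec_mulVec, Matrix.mul_assoc]
  have hmul (xt : Fin (n - nc) → ℂ)
      (hxt : lam ^ 2 • ((Γ₀ᵀ * M * Γ₀).map Complex.ofReal *ᵥ xt)
        + lam • ((Γ₀ᵀ * Cd * Γ₀).map Complex.ofReal *ᵥ xt)
        + (Γ₀ᵀ * K * Γ₀).map Complex.ofReal *ᵥ xt = 0) :
      ∃! μh : Fin nc → ℂ,
        lam ^ 2 • (M.map Complex.ofReal *ᵥ (Γ₀.map Complex.ofReal *ᵥ xt))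
          + lam • (Cd.map Complex.ofReal *ᵥ (Γ₀.map Complex.ofReal *ᵥ xt))
          + K.map Complex.ofReal *ᵥ (Γ₀.map Complex.ofReal *ᵥ xt)
          + (G₀ᵀ).map Complex.ofReal *ᵥ μh = 0 := by
    rw [hred] at hxt
    generalize lam ^ 2 • (M.map Complex.ofReal *ᵥ (Γ₀.map Complex.ofReal *ᵥ xt))
          + lam • (Cd.map Complex.ofReal *ᵥ (Γ₀.map Complex.ofReal *ᵥ xt))
          + K.map Complex.ofReal *ᵥ (Γ₀.map Complex.ofReal *ᵥ xt) = r at hxt ⊢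
    refine ⟨-((Rᵀ).map Complex.ofReal *ᵥ r), ?_, fun μ hμ => ?_⟩
    · have h := congrArg (· *ᵥ r) hsplitT
      simp only [add_mulVec, ← mulVec_mulVec, hxt, mulVec_zero, add_zero, one_mulVec] at h
      simp only [mulVec_neg, h, add_neg_cancel]
    · have h := congrArg ((Rᵀ).map Complex.ofReal *ᵥ ·) hμ
      simp only [mulVec_add, mulVec_mulVec, hRG, one_mulVec, mulVec_zero] at h
      exact eq_neg_of_add_eq_zero_right h
  refine ⟨⟨?_, ?_⟩, hmul⟩
  · rintro ⟨x, hx, μ, hμ, hGx⟩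
    have hxL : Γ₀.map Complex.ofReal *ᵥ (L.map Complex.ofReal *ᵥ x) = x := by
      have h := congrArg (· *ᵥ x) hsplit
      simpa only [add_mulVec, ← mulVec_mulVec, hGx, mulVec_zero, zero_add, one_mulVec] using h
    refine ⟨L.map Complex.ofReal *ᵥ x, fun h => hx ?_, ?_⟩
    · rw [← hxL, h, mulVec_zero]
    · rw [hred, hxL, eq_neg_of_add_eq_zero_left hμ, mulVec_neg, mulVec_mulVec, hΓG,
        zero_mulVec, neg_zero]
  · rintro ⟨xt, hxt, h⟩
    obtain ⟨μ, hμ, -⟩ := hmul xt h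
    refine ⟨Γ₀.map Complex.ofReal *ᵥ xt, fun h0 => hxt ?_, μ, hμ, ?_⟩
    · rw [← one_mulVec xt, ← hLΓ, ← mulVec_mulVec, h0, mulVec_zero]
    · rw [mulVec_mulVec, hGΓ', zero_mulVec]
end

section
/- Let M, C, K ∈ ℝ^{n×n}, α ∈ ℝ, and let G₀ ∈ ℝ^{n_c×n}, Ǧ₀ ∈ ℝ^{(n−n_c)×n}, Γ̌₀ ∈ ℝ^{n×n_c}, Γ₀ ∈ ℝ^{n×(n−n_c)} satisfy the inverse identities G₀Γ̌₀ = I, G₀Γ₀ = 0, Ǧ₀Γ̌₀ = 0, Ǧ₀Γ₀ = I and Γ̌₀G₀ + Γ₀Ǧ₀ = I; regard all matrices as complex matrices. For every λ ∈ ℂ with λ ≠ −α, the following are equivalent: (i) there exists a nonzero pair (x̂, ê) ∈ ℂⁿ × ℂ^{n−n_c} satisfying λx̂ = −αΓ̌₀G₀x̂ + Γ₀ê and λ(Γ₀ᵀC − αΓ₀ᵀMΓ̌₀G₀)x̂ + λΓ₀ᵀMΓ₀ê + Γ₀ᵀKx̂ = 0; (ii) there exists x̃ ∈ ℂ^{n−n_c}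 with x̃ ≠ 0 such that (λ²Γ₀ᵀMΓ₀ + λΓ₀ᵀCΓ₀ + Γ₀ᵀKΓ₀)x̃ = 0. Moreover, any solution in (i) has the form x̂ = Γ₀x̃ and ê = λx̃ with x̃ as in (ii). -/
open Matrix

/-- Away from `lam = -a`, the solutions of the kinematic eigenvalue equation are exactly the pairs
`(Γ *ᵥ z, lam • z)`. -/
theorem kinematic_eigen_iff {F m c r : Type*} [Field F] [Fintype m] [Fintype c] [Fintype r]
    [DecidableEq m] [DecidableEq c] [DecidableEq r] {G : Matrix c m F} {Gv : Matrix r m F} {Γc : Matrix m c F}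
    {Γ : Matrix m r F} (hGΓc : G * Γc = 1) (hGΓ : G * Γ = 0) (hGvΓc : Gv * Γc = 0)
    (hGvΓ : Gv * Γ = 1) (hsum : Γc * G + Γ * Gv = 1) {lam a : F} (hlam : lam ≠ -a)
    (x : m → F) (e : r → F) :
    lam • x = -(a • ((Γc * G) *ᵥ x)) + Γ *ᵥ e ↔ ∃ z : r → F, x = Γ *ᵥ z ∧ e = lam • z := by
  constructor
  · intro h
    have hG : G *ᵥ x = 0 := by
      have h1 := congrArg (G *ᵥ ·) h
      simp only [mulVec_add, mulVec_neg, mulVec_smul, mulVec_mulVec, ← Matrix.mul_assoc, hGΓc,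
        hGΓ, Matrix.one_mul, zero_mulVec, add_zero] at h1
      have h2 : (lam + a) • (G *ᵥ x) = 0 := by rw [add_smul, h1, neg_add_cancel]
      exact (smul_eq_zero.mp h2).resolve_left fun h3 => hlam (eq_neg_of_add_eq_zero_left h3)
    have hx : x = Γ *ᵥ (Gv *ᵥ x) := by
      have h1 := congrArg (· *ᵥ x) hsum
      simp only [add_mulVec, ← mulVec_mulVec, hG, mulVec_zero, zero_add, one_mulVec] at h1
      exact h1.symm
    refine ⟨Gv *ᵥ x, hx, ?_⟩
    have h1 := congrArg (Gv *ᵥ ·) h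
    simp only [mulVec_add, mulVec_neg, mulVec_smul, mulVec_mulVec, ← Matrix.mul_assoc, hGvΓc,
      hGvΓ, Matrix.zero_mul, zero_mulVec, one_mulVec, smul_zero, neg_zero, zero_add] at h1
    exact h1.symm
  · rintro ⟨z, rfl, rfl⟩
    simp [Matrix.mul_assoc, hGΓ, mulVec_smul]

/-- On the pairs `(Γ *ᵥ z, lam • z)`, the dynamic residual is the residual of the reduced quadratic
eigenvalue problem. -/
theorem dynamic_residual_eq {F m c r : Type*} [Field F] [Fintype m] [Fintype c] [Fintype r]
    {G : Matrix c m F} {Γ : Matrix m r F} (hGΓ : G * Γ = 0) (B : Matrix r c F) (C K : Matrix r m F)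
    (A : Matrix r r F) (lam a : F) (z : r → F) :
    lam • (C *ᵥ (Γ *ᵥ z) - a • ((B * G) *ᵥ (Γ *ᵥ z))) + lam • (A *ᵥ (lam • z)) + K *ᵥ (Γ *ᵥ z) =
      lam ^ 2 • (A *ᵥ z) + lam • ((C * Γ) *ᵥ z) + (K * Γ) *ᵥ z := by
  simp only [mulVec_mulVec, Matrix.mul_assoc, hGΓ, Matrix.mul_zero, zero_mulVec, smul_zero,
    sub_zero, mulVec_smul, smul_smul, pow_two, add_comm (lam • _)]

/-- For λ ≠ −α, the eigenvalue problem of the linearized Maggi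
ODE system is equivalent to the reduced quadratic eigenvalue problem; moreover
any solution has the form x̂ = Γ₀x̃, ê = λx̃. -/
theorem maggi_reduced_spectrum_equivalence {n nc : ℕ} (hnc : 0 < nc) (hn : nc < n)
    (M Cd K : Matrix (Fin n) (Fin n) ℝ) (α : ℝ)
    (G₀ : Matrix (Fin nc) (Fin n) ℝ) (Gv₀ : Matrix (Fin (n - nc)) (Fin n) ℝ)
    (Γc₀ : Matrix (Fin n) (Fin nc) ℝ) (Γ₀ : Matrix (Fin n) (Fin (n - nc)) ℝ)
    (hGΓc : G₀ * Γc₀ = 1) (hGΓ : G₀ * Γ₀ = 0)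
    (hGvΓc : Gv₀ * Γc₀ = 0) (hGvΓ : Gv₀ * Γ₀ = 1)
    (hsum : Γc₀ * G₀ + Γ₀ * Gv₀ = 1) :
    ∀ lam : ℂ, lam ≠ -(α : ℂ) →
      ((∃ xh : Fin n → ℂ, ∃ eh : Fin (n - nc) → ℂ, ¬(xh = 0 ∧ eh = 0) ∧
          lam • xh = -((α : ℂ) • ((Γc₀ * G₀).map Complex.ofReal *ᵥ xh))
            + Γ₀.map Complex.ofReal *ᵥ eh ∧
          lam • ((Γ₀ᵀ * Cd).map Complex.ofReal *ᵥ xh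
              - (α : ℂ) • ((Γ₀ᵀ * M * Γc₀ * G₀).map Complex.ofReal *ᵥ xh))
            + lam • ((Γ₀ᵀ * M * Γ₀).map Complex.ofReal *ᵥ eh)
            + (Γ₀ᵀ * K).map Complex.ofReal *ᵥ xh = 0) ↔
        (∃ xt : Fin (n - nc) → ℂ, xt ≠ 0 ∧
          lam ^ 2 • ((Γ₀ᵀ * M * Γ₀).map Complex.ofReal *ᵥ xt)
            + lam • ((Γ₀ᵀ * Cd * Γ₀).map Complex.ofReal *ᵥ xt)
            + (Γ₀ᵀ * K * Γ₀).map Complex.ofReal *ᵥ xt = 0)) ∧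
      (∀ (xh : Fin n → ℂ) (eh : Fin (n - nc) → ℂ),
          lam • xh = -((α : ℂ) • ((Γc₀ * G₀).map Complex.ofReal *ᵥ xh))
            + Γ₀.map Complex.ofReal *ᵥ eh →
          lam • ((Γ₀ᵀ * Cd).map Complex.ofReal *ᵥ xh
              - (α : ℂ) • ((Γ₀ᵀ * M * Γc₀ * G₀).map Complex.ofReal *ᵥ xh))
            + lam • ((Γ₀ᵀ * M * Γ₀).map Complex.ofReal *ᵥ eh)
            + (Γ₀ᵀ * K).map Complex.ofReal *ᵥ xh = 0 →
        ∃ xt : Fin (n - nc) → ℂ,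
          xh = Γ₀.map Complex.ofReal *ᵥ xt ∧ eh = lam • xt ∧
          lam ^ 2 • ((Γ₀ᵀ * M * Γ₀).map Complex.ofReal *ᵥ xt)
            + lam • ((Γ₀ᵀ * Cd * Γ₀).map Complex.ofReal *ᵥ xt)
            + (Γ₀ᵀ * K * Γ₀).map Complex.ofReal *ᵥ xt = 0) := by
  intro lam hlam
  have map_mul' {p q s : ℕ} (A : Matrix (Fin p) (Fin q) ℝ) (B : Matrix (Fin q) (Fin s) ℝ) :
      (A * B).map Complex.ofReal = A.map Complex.ofReal * B.map Complex.ofReal :=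
    Matrix.map_mul (f := Complex.ofRealHom)
  have map_one' (p : ℕ) : (1 : Matrix (Fin p) (Fin p) ℝ).map Complex.ofReal = 1 :=
    Matrix.map_one _ Complex.ofReal_zero Complex.ofReal_one
  have map_zero' (p q : ℕ) : (0 : Matrix (Fin p) (Fin q) ℝ).map Complex.ofReal = 0 :=
    Matrix.map_zero _ Complex.ofReal_zero
  have hGΓc' := congrArg (Matrix.map · Complex.ofReal) hGΓc
  have hGΓ' := congrArg (Matrix.map · Complex.ofReal) hGΓ
  have hGvΓc' := congrArg (Matrix.map · Complex.ofReal) hGvΓc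
  have hGvΓ' := congrArg (Matrix.map · Complex.ofReal) hGvΓ
  have hsum' := congrArg (Matrix.map · Complex.ofReal) hsum
  simp only [Matrix.map_add _ Complex.ofReal_add, map_mul', map_one', map_zero']
    at hGΓc' hGΓ' hGvΓc' hGvΓ' hsum'
  have kin := kinematic_eigen_iff hGΓc' hGΓ' hGvΓc' hGvΓ' hsum' hlam
  have dyn := dynamic_residual_eq hGΓ' ((Γ₀ᵀ * M * Γc₀).map Complex.ofReal)
    ((Γ₀ᵀ * Cd).map Complex.ofReal) ((Γ₀ᵀ * K).map Complex.ofReal)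
    ((Γ₀ᵀ * M * Γ₀).map Complex.ofReal) lam α
  simp only [← map_mul'] at kin dyn
  refine ⟨⟨?_, ?_⟩, ?_⟩
  · rintro ⟨xh, eh, hne, h₁, h₂⟩
    obtain ⟨z, rfl, rfl⟩ := (kin xh eh).mp h₁
    refine ⟨z, ?_, (dyn z).symm.trans h₂⟩
    rintro rfl
    exact hne ⟨mulVec_zero _, smul_zero _⟩
  · rintro ⟨z, hz, h⟩
    refine ⟨_, _, ?_, (kin _ _).mpr ⟨z, rfl, rfl⟩, (dyn z).trans h⟩
    rintro ⟨hx, -⟩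
    apply hz
    rw [← one_mulVec z, ← hGvΓ', ← mulVec_mulVec, hx, mulVec_zero]
  · intro xh eh h₁ h₂
    obtain ⟨z, rfl, rfl⟩ := (kin xh eh).mp h₁
    exact ⟨z, rfl, rfl, (dyn z).symm.trans h₂⟩
end

section
/- Let M, C, K ∈ ℝ^{n×n}, α ∈ ℝ with α > 0, suppose the matrix α²M − αC + K is invertible, let G₀ ∈ ℝ^{n_c×n} have full row rank n_c, and let Ǧ₀, Γ̌₀, Γ₀ satisfy the inverse identities G₀Γ̌₀ = I, G₀Γ₀ = 0, Ǧ₀Γ̌₀ = 0, Ǧ₀Γ₀ = I and Γ̌₀G₀ + Γ₀Ǧ₀ = I. For each w ∈ ℝ^{n_c}, define x̂ := (α²M − αC + K)⁻¹G₀ᵀw and ê := −αǦ₀x̂. Then (x̂, ê) satisfies the eigenvalue equations of the linearized Maggi system with eigenvalue λ = −α, namely −αx̂ = −αΓ̌₀G₀x̂ + Γ₀ê and −α(Γ₀ᵀC − αΓ₀ᵀMΓ̌₀G₀)x̂ − αΓ₀ᵀMΓ₀ê + Γ₀ᵀKx̂ = 0; moreover the linear map w ↦ (x̂, ê) is injective,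 so that λ = −α is an eigenvalue of the linearized Maggi system of geometric multiplicity at least n_c. -/
open Matrix

/-- λ = −α is an eigenvalue of the linearized Maggi system: for
each w ∈ ℝ^{n_c}, the pair x̂ = (α²M − αC + K)⁻¹G₀ᵀw, ê = −αǦ₀x̂ satisfies the
eigenvalue equations with λ = −α, and the map w ↦ (x̂, ê) is injective, so the
geometric multiplicity of −α is at least n_c. -/
theorem maggi_spurious_eigenvalue {n nc : ℕ} (hnc : 0 < nc) (hn : nc < n)
    (M Cd K : Matrix (Fin n) (Fin n) ℝ) (α : ℝ) (hα : 0 < α)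
    (hN : IsUnit (α ^ 2 • M - α • Cd + K))
    (G₀ : Matrix (Fin nc) (Fin n) ℝ) (hG : G₀.rank = nc)
    (Gv₀ : Matrix (Fin (n - nc)) (Fin n) ℝ)
    (Γc₀ : Matrix (Fin n) (Fin nc) ℝ) (Γ₀ : Matrix (Fin n) (Fin (n - nc)) ℝ)
    (hGΓc : G₀ * Γc₀ = 1) (hGΓ : G₀ * Γ₀ = 0)
    (hGvΓc : Gv₀ * Γc₀ = 0) (hGvΓ : Gv₀ * Γ₀ = 1)
    (hsum : Γc₀ * G₀ + Γ₀ * Gv₀ = 1) :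
    (∀ w : Fin nc → ℝ,
      (-α) • ((α ^ 2 • M - α • Cd + K)⁻¹ *ᵥ (G₀ᵀ *ᵥ w))
        = (-α) • ((Γc₀ * G₀) *ᵥ ((α ^ 2 • M - α • Cd + K)⁻¹ *ᵥ (G₀ᵀ *ᵥ w)))
          + Γ₀ *ᵥ (-α • (Gv₀ *ᵥ ((α ^ 2 • M - α • Cd + K)⁻¹ *ᵥ (G₀ᵀ *ᵥ w)))) ∧
      (-α) • ((Γ₀ᵀ * Cd) *ᵥ ((α ^ 2 • M - α • Cd + K)⁻¹ *ᵥ (G₀ᵀ *ᵥ w))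
            - α • ((Γ₀ᵀ * M * Γc₀ * G₀) *ᵥ ((α ^ 2 • M - α • Cd + K)⁻¹ *ᵥ (G₀ᵀ *ᵥ w))))
        + (-α) • ((Γ₀ᵀ * M * Γ₀) *ᵥ
            (-α • (Gv₀ *ᵥ ((α ^ 2 • M - α • Cd + K)⁻¹ *ᵥ (G₀ᵀ *ᵥ w)))))
        + (Γ₀ᵀ * K) *ᵥ ((α ^ 2 • M - α • Cd + K)⁻¹ *ᵥ (G₀ᵀ *ᵥ w)) = 0) ∧
    Function.Injective (fun w : Fin nc → ℝ =>
      (((α ^ 2 • M - α • Cd + K)⁻¹ *ᵥ (G₀ᵀ *ᵥ w)),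
        -α • (Gv₀ *ᵥ ((α ^ 2 • M - α • Cd + K)⁻¹ *ᵥ (G₀ᵀ *ᵥ w))))) := by
  have hdet := (isUnit_iff_isUnit_det _).mp hN
  refine ⟨fun w => ?_, fun w₁ w₂ h => ?_⟩
  · have hx : (α ^ 2 • M - α • Cd + K) *ᵥ ((α ^ 2 • M - α • Cd + K)⁻¹ *ᵥ (G₀ᵀ *ᵥ w))
        = G₀ᵀ *ᵥ w := by
      rw [mulVec_mulVec, mul_nonsing_inv _ hdet, one_mulVec]
    generalize (α ^ 2 • M - α • Cd + K)⁻¹ *ᵥ (G₀ᵀ *ᵥ w) = x at hx ⊢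
    have hdecomp : (Γc₀ * G₀) *ᵥ x + Γ₀ *ᵥ (Gv₀ *ᵥ x) = x := by
      rw [mulVec_mulVec, ← add_mulVec, hsum, one_mulVec]
    refine ⟨?_, ?_⟩
    · rw [mulVec_smul, ← smul_add, hdecomp]
    · have hker : Γ₀ᵀ *ᵥ (G₀ᵀ *ᵥ w) = 0 := by
        rw [mulVec_mulVec, ← transpose_mul, hGΓ, transpose_zero, zero_mulVec]
      have hM : (Γ₀ᵀ * M * Γc₀ * G₀) *ᵥ x + (Γ₀ᵀ * M * Γ₀) *ᵥ (Gv₀ *ᵥ x)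
          = (Γ₀ᵀ * M) *ᵥ x := by
        rw [mulVec_mulVec, ← add_mulVec, Matrix.mul_assoc _ Γc₀, Matrix.mul_assoc _ Γ₀,
          ← Matrix.mul_add, hsum, Matrix.mul_one]
      have hforce : α ^ 2 • ((Γ₀ᵀ * M) *ᵥ x) - α • ((Γ₀ᵀ * Cd) *ᵥ x) + (Γ₀ᵀ * K) *ᵥ x = 0 := by
        rw [← hker, ← hx]
        simp only [add_mulVec, sub_mulVec, smul_mulVec, mulVec_add, mulVec_sub, mulVec_smul,
          mulVec_mulVec]
      rw [← hforce, ← hM, mulVec_smul]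
      module
  · have hx : (α ^ 2 • M - α • Cd + K)⁻¹ *ᵥ (G₀ᵀ *ᵥ w₁)
        = (α ^ 2 • M - α • Cd + K)⁻¹ *ᵥ (G₀ᵀ *ᵥ w₂) := congrArg Prod.fst h
    have hG₀w := congrArg (fun v => Γc₀ᵀ *ᵥ ((α ^ 2 • M - α • Cd + K) *ᵥ v)) hx
    simpa only [mulVec_mulVec, ← Matrix.mul_assoc, mul_nonsing_inv_cancel_right _ _ hdet,
      ← transpose_mul, hGΓc, transpose_one, one_mulVec] using hG₀w
end

section
/- Let M, C, K ∈ ℝ^{n×n}, α ∈ ℝ, let G₀ ∈ ℝ^{n_c×n} have full row rank n_c, let Γ₀ ∈ ℝ^{n×(n−n_c)} have full column rank n−n_c, and let Ǧ₀, Γ̌₀ satisfy the inverse identities G₀Γ̌₀ = I, G₀Γ₀ = 0, Ǧ₀Γ̌₀ = 0, Ǧ₀Γ₀ = I and Γ̌₀G₀ + Γ₀Ǧ₀ = I; regard all matrices as complex matrices. For every λ ∈ ℂ with λ ≠ −α, the following are equivalent: (i) there exists a nonzero pair (x̂, ê) ∈ ℂⁿ × ℂ^{n−n_c} satisfying λx̂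 = −αΓ̌₀G₀x̂ + Γ₀ê and λ(Γ₀ᵀC − αΓ₀ᵀMΓ̌₀G₀)x̂ + λΓ₀ᵀMΓ₀ê + Γ₀ᵀKx̂ = 0; (ii) there exist x̂' ∈ ℂⁿ with x̂' ≠ 0 and μ̂ ∈ ℂ^{n_c} such that λ²Mx̂' + λCx̂' + Kx̂' + G₀ᵀμ̂ = 0 and G₀x̂' = 0. Moreover one can take x̂' = x̂, i.e. the eigenvalues away from −α of the linearized Maggi ODE system coincide, together with their displacement eigenvector components, with the finite-magnitude eigenvalues of the linearized constrained differential-algebraic system. -/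
open Matrix

namespace Matrix

variable {F m p q : Type*} [Field F] [Fintype m] [Fintype p] [Fintype q]

/-- A solution of the stabilized kinematic equation satisfies the constraint away from `-a`. -/
theorem mulVec_eq_zero_of_stabilized [DecidableEq p] {G : Matrix p m F} {Γ : Matrix m q F}
    {H : Matrix m p F} (hGH : G * H = 1) (hGΓ : G * Γ = 0) {a l : F} (hl : l ≠ -a)
    {x : m → F} {e : q → F} (h : l • x = -(a • ((H * G) *ᵥ x)) + Γ *ᵥ e) :
    G *ᵥ x = 0 := by
  have h1 := congrArg (G *ᵥ ·) h
  simp only [mulVec_add, mulVec_neg, mulVec_smul, mulVec_mulVec, ← Matrix.mul_assoc, hGH, hGΓ,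
    Matrix.one_mul, zero_mulVec, add_zero] at h1
  have h2 : (l + a) • (G *ᵥ x) = 0 := by rw [add_smul, h1, neg_add_cancel]
  exact (smul_eq_zero.mp h2).resolve_left fun h3 => hl (eq_neg_of_add_eq_zero_left h3)

/-- On the kernel of the constraint Jacobian, the reduced dynamic equation is the projection of
the quadratic eigenvalue residual. -/
theorem reduced_eq_mulVec_residual {M C K : Matrix m m F} {G : Matrix p m F} {Γ : Matrix m q F}
    {H : Matrix m p F} {a l : F} {x : m → F} {e : q → F} (hx : G *ᵥ x = 0)
    (he : Γ *ᵥ e = l • x) :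
    l • ((Γᵀ * C) *ᵥ x - a • ((Γᵀ * M * H * G) *ᵥ x)) + l • ((Γᵀ * M * Γ) *ᵥ e)
      + (Γᵀ * K) *ᵥ x = Γᵀ *ᵥ (l ^ 2 • (M *ᵥ x) + l • (C *ᵥ x) + K *ᵥ x) := by
  simp only [← mulVec_mulVec, hx, he, mulVec_zero, smul_zero, sub_zero, mulVec_add, mulVec_smul,
    smul_smul, pow_two]
  abel

/-- A vector annihilated by `Γᵀ` is in the range of `Gᵀ`. -/
theorem exists_add_transpose_mulVec_eq_zero [DecidableEq m] {G : Matrix p m F}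
    {Γ : Matrix m q F} {N : Matrix q m F} {H : Matrix m p F} (hsum : H * G + Γ * N = 1)
    {r : m → F} (hr : Γᵀ *ᵥ r = 0) : ∃ μ : p → F, r + Gᵀ *ᵥ μ = 0 := by
  refine ⟨-(Hᵀ *ᵥ r), ?_⟩
  have h := congrArg (fun A : Matrix m m F => Aᵀ *ᵥ r) hsum
  simp only [transpose_add, transpose_mul, transpose_one, add_mulVec, ← mulVec_mulVec, hr,
    mulVec_zero, add_zero, one_mulVec] at h
  rw [mulVec_neg, h, add_neg_cancel]

/-- Away from `-a`, a nonzero reduced eigenvector yields a constrained eigenvector with the same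
displacement component. -/
theorem constrained_of_reduced [DecidableEq m] [DecidableEq p] [DecidableEq q]
    {M C K : Matrix m m F} {G : Matrix p m F} {Γ : Matrix m q F} {N : Matrix q m F}
    {H : Matrix m p F} (hGH : G * H = 1) (hGΓ : G * Γ = 0) (hNΓ : N * Γ = 1)
    (hsum : H * G + Γ * N = 1) {a l : F} (hl : l ≠ -a) {x : m → F} {e : q → F}
    (hne : ¬(x = 0 ∧ e = 0)) (h₁ : l • x = -(a • ((H * G) *ᵥ x)) + Γ *ᵥ e)
    (h₂ : l • ((Γᵀ * C) *ᵥ x - a • ((Γᵀ * M * H * G) *ᵥ x)) + l • ((Γᵀ * M * Γ) *ᵥ e)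
      + (Γᵀ * K) *ᵥ x = 0) :
    x ≠ 0 ∧ ∃ μ : p → F,
      l ^ 2 • (M *ᵥ x) + l • (C *ᵥ x) + K *ᵥ x + Gᵀ *ᵥ μ = 0 ∧ G *ᵥ x = 0 := by
  have hx := mulVec_eq_zero_of_stabilized hGH hGΓ hl h₁
  have he : Γ *ᵥ e = l • x := by
    rw [h₁, ← mulVec_mulVec, hx, mulVec_zero, smul_zero, neg_zero, zero_add]
  refine ⟨fun h0 => hne ⟨h0, ?_⟩, ?_⟩
  · rw [← one_mulVec e, ← hNΓ, ← mulVec_mulVec, he, h0, smul_zero, mulVec_zero]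
  · rw [reduced_eq_mulVec_residual hx he] at h₂
    obtain ⟨μ, hμ⟩ := exists_add_transpose_mulVec_eq_zero hsum h₂
    exact ⟨μ, hμ, hx⟩

/-- A constrained eigenvector yields a reduced eigenvector with the same displacement
component. -/
theorem reduced_of_constrained [DecidableEq m] {M C K : Matrix m m F} {G : Matrix p m F}
    {Γ : Matrix m q F} {N : Matrix q m F} {H : Matrix m p F} (hGΓ : G * Γ = 0)
    (hsum : H * G + Γ * N = 1) (a : F) {l : F} {x : m → F} {μ : p → F}
    (h : l ^ 2 • (M *ᵥ x) + l • (C *ᵥ x) + K *ᵥ x + Gᵀ *ᵥ μ = 0) (hx : G *ᵥ x = 0) :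
    ∃ e : q → F, l • x = -(a • ((H * G) *ᵥ x)) + Γ *ᵥ e ∧
      l • ((Γᵀ * C) *ᵥ x - a • ((Γᵀ * M * H * G) *ᵥ x)) + l • ((Γᵀ * M * Γ) *ᵥ e)
        + (Γᵀ * K) *ᵥ x = 0 := by
  have hN : Γ *ᵥ (N *ᵥ x) = x := by
    have h0 := congrArg (· *ᵥ x) hsum
    simpa only [add_mulVec, ← mulVec_mulVec, hx, mulVec_zero, zero_add, one_mulVec] using h0
  have he : Γ *ᵥ (l • (N *ᵥ x)) = l • x := by rw [mulVec_smul, hN]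
  refine ⟨l • (N *ᵥ x), ?_, ?_⟩
  · rw [he, ← mulVec_mulVec, hx, mulVec_zero, smul_zero, neg_zero, zero_add]
  · rw [reduced_eq_mulVec_residual hx he, eq_neg_of_add_eq_zero_left h, mulVec_neg,
      mulVec_mulVec, ← transpose_mul, hGΓ, transpose_zero, zero_mulVec, neg_zero]

/-- Complexification of real matrices is multiplicative. -/
theorem map_ofReal_mul {i j k : Type*} [Fintype j] (A : Matrix i j ℝ) (B : Matrix j k ℝ) :
    (A * B).map Complex.ofReal = A.map Complex.ofReal * B.map Complex.ofReal :=
  Matrix.map_mul (f := Complex.ofRealHom)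

end Matrix

/-- Theorem 4 of the paper: For λ ≠ −α, the eigenvalue problem
of the linearized Maggi ODE system is equivalent to the finite-magnitude
eigenvalue problem of the linearized constrained DAE system; moreover one can
take the same displacement eigenvector component x̂' = x̂. -/
theorem maggi_dae_spectrum_equivalence {n nc : ℕ} (hnc : 0 < nc) (hn : nc < n)
    (M Cd K : Matrix (Fin n) (Fin n) ℝ) (α : ℝ)
    (G₀ : Matrix (Fin nc) (Fin n) ℝ) (hG : G₀.rank = nc)
    (Γ₀ : Matrix (Fin n) (Fin (n - nc)) ℝ) (hΓ : Γ₀.rank = n - nc)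
    (Gv₀ : Matrix (Fin (n - nc)) (Fin n) ℝ) (Γc₀ : Matrix (Fin n) (Fin nc) ℝ)
    (hGΓc : G₀ * Γc₀ = 1) (hGΓ : G₀ * Γ₀ = 0)
    (hGvΓc : Gv₀ * Γc₀ = 0) (hGvΓ : Gv₀ * Γ₀ = 1)
    (hsum : Γc₀ * G₀ + Γ₀ * Gv₀ = 1) :
    ∀ lam : ℂ, lam ≠ -(α : ℂ) →
      ((∃ xh : Fin n → ℂ, ∃ eh : Fin (n - nc) → ℂ, ¬(xh = 0 ∧ eh = 0) ∧
          lam • xh = -((α : ℂ) • ((Γc₀ * G₀).map Complex.ofReal *ᵥ xh))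
            + Γ₀.map Complex.ofReal *ᵥ eh ∧
          lam • ((Γ₀ᵀ * Cd).map Complex.ofReal *ᵥ xh
              - (α : ℂ) • ((Γ₀ᵀ * M * Γc₀ * G₀).map Complex.ofReal *ᵥ xh))
            + lam • ((Γ₀ᵀ * M * Γ₀).map Complex.ofReal *ᵥ eh)
            + (Γ₀ᵀ * K).map Complex.ofReal *ᵥ xh = 0) ↔
        (∃ xh' : Fin n → ℂ, xh' ≠ 0 ∧ ∃ μh : Fin nc → ℂ,
          lam ^ 2 • (M.map Complex.ofReal *ᵥ xh')
            + lam • (Cd.map Complex.ofReal *ᵥ xh')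
            + K.map Complex.ofReal *ᵥ xh'
            + (G₀ᵀ).map Complex.ofReal *ᵥ μh = 0 ∧
          G₀.map Complex.ofReal *ᵥ xh' = 0)) ∧
      (∀ (xh : Fin n → ℂ) (eh : Fin (n - nc) → ℂ), ¬(xh = 0 ∧ eh = 0) →
          lam • xh = -((α : ℂ) • ((Γc₀ * G₀).map Complex.ofReal *ᵥ xh))
            + Γ₀.map Complex.ofReal *ᵥ eh →
          lam • ((Γ₀ᵀ * Cd).map Complex.ofReal *ᵥ xh
              - (α : ℂ) • ((Γ₀ᵀ * M * Γc₀ * G₀).map Complex.ofReal *ᵥ xh))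
            + lam • ((Γ₀ᵀ * M * Γ₀).map Complex.ofReal *ᵥ eh)
            + (Γ₀ᵀ * K).map Complex.ofReal *ᵥ xh = 0 →
        xh ≠ 0 ∧ ∃ μh : Fin nc → ℂ,
          lam ^ 2 • (M.map Complex.ofReal *ᵥ xh)
            + lam • (Cd.map Complex.ofReal *ᵥ xh)
            + K.map Complex.ofReal *ᵥ xh
            + (G₀ᵀ).map Complex.ofReal *ᵥ μh = 0 ∧
          G₀.map Complex.ofReal *ᵥ xh = 0) := by
  have map_one' : ∀ k : ℕ, (1 : Matrix (Fin k) (Fin k) ℝ).map Complex.ofReal = 1 := fun k =>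
    Matrix.map_one _ Complex.ofReal_zero Complex.ofReal_one
  replace hGΓc := congrArg (·.map Complex.ofReal) hGΓc
  replace hGΓ := congrArg (·.map Complex.ofReal) hGΓ
  replace hGvΓ := congrArg (·.map Complex.ofReal) hGvΓ
  replace hsum := congrArg (·.map Complex.ofReal) hsum
  simp only [Matrix.map_add _ Complex.ofReal_add, map_ofReal_mul, map_one',
    Matrix.map_zero _ Complex.ofReal_zero] at hGΓc hGΓ hGvΓ hsum
  simp only [map_ofReal_mul]
  intro lam hlam
  refine ⟨⟨?_, ?_⟩, fun xh eh hne h₁ h₂ =>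
    constrained_of_reduced hGΓc hGΓ hGvΓ hsum hlam hne h₁ h₂⟩
  · rintro ⟨xh, eh, hne, h₁, h₂⟩
    exact ⟨xh, constrained_of_reduced hGΓc hGΓ hGvΓ hsum hlam hne h₁ h₂⟩
  · rintro ⟨xh, hne, μh, h, hx⟩
    obtain ⟨eh, h₁, h₂⟩ := reduced_of_constrained hGΓ hsum (α : ℂ) h hx
    exact ⟨xh, eh, fun h0 => hne h0.1, h₁, h₂⟩
end

section
/- Let c, ε, Ω ∈ ℝ and let z₁, z₂, z₃, z₄: ℝ → ℝ be differentiable functions satisfying, for all t: ż₁(t) = z₂(t), ż₂(t) = −c z₂(t) − z₃(t) + ε cos(Ωt), ż₃(t) = (1 + z₄(t)) z₂(t), z₃(t)² + (1 + z₄(t))² = 1, and 1 + z₄(t) ≠ 0. If the initial conditions are consistent, i.e. z₃(0) = sin(z₁(0)) and z₄(0) = cos(z₁(0)) − 1, then for all t: z₃(t) = sin(z₁(t)) and z₄(t) = cos(z₁(t)) − 1, and consequently z₁ solves the forced pendulum equation z̈₁(t) + c ż₁(t) + sin(z₁(t)) = ε cos(Ωt). -/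
/-- Converse of the pendulum recasting: any solution of the
polynomial DAE with consistent initial data for the auxiliary variables
satisfies z₃ = sin z₁, z₄ = cos z₁ − 1 for all time, and hence z₁ solves the
forced pendulum equation z̈₁ + cż₁ + sin z₁ = ε cos Ωt. -/
theorem pendulum_recast_backward (c ε Ω : ℝ) (z₁ z₂ z₃ z₄ : ℝ → ℝ)
    (h1 : ∀ t, HasDerivAt z₁ (z₂ t) t)
    (h2 : ∀ t, HasDerivAt z₂ (-c * z₂ t - z₃ t + ε * Real.cos (Ω * t)) t)
    (h3 : ∀ t, HasDerivAt z₃ ((1 + z₄ t) * z₂ t) t)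
    (h4 : Differentiable ℝ z₄)
    (hcon : ∀ t, z₃ t ^ 2 + (1 + z₄ t) ^ 2 = 1)
    (hne : ∀ t, 1 + z₄ t ≠ 0)
    (hi3 : z₃ 0 = Real.sin (z₁ 0))
    (hi4 : z₄ 0 = Real.cos (z₁ 0) - 1) :
    (∀ t, z₃ t = Real.sin (z₁ t) ∧ z₄ t = Real.cos (z₁ t) - 1) ∧
    (∀ t, HasDerivAt z₂
        (-c * z₂ t - Real.sin (z₁ t) + ε * Real.cos (Ω * t)) t) := by
  have h4' : ∀ t, HasDerivAt z₄ (-z₃ t * z₂ t) t := by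
    intro t
    have hd := (h4 t).hasDerivAt
    have hsum := ((h3 t).pow 2).add ((hd.const_add 1).pow 2)
    have hone : z₃ ^ 2 + (fun s => 1 + z₄ s) ^ 2 = fun _ => (1 : ℝ) := funext hcon
    rw [hone] at hsum
    have hzero := hsum.unique (hasDerivAt_const t (1 : ℝ))
    have hderiv : deriv z₄ t = -z₃ t * z₂ t := by
      apply mul_left_cancel₀ (hne t)
      norm_num at hzero
      linear_combination hzero / 2
    rwa [hderiv] at hd
  have hw : ∀ t, HasDerivAt
      (fun s => z₃ s * Real.sin (z₁ s) + (1 + z₄ s) * Real.cos (z₁ s)) 0 t := by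
    intro t
    have hd := ((h3 t).mul (h1 t).sin).add (((h4' t).const_add 1).mul (h1 t).cos)
    exact hd.congr_deriv (by ring)
  have haux : ∀ t, z₃ t = Real.sin (z₁ t) ∧ z₄ t = Real.cos (z₁ t) - 1 := by
    intro t
    have hconst := is_const_of_deriv_eq_zero (fun s => (hw s).differentiableAt)
      (fun s => (hw s).deriv) t 0
    simp only [hi3, hi4] at hconst
    have hsq : (z₃ t - Real.sin (z₁ t)) ^ 2 + (1 + z₄ t - Real.cos (z₁ t)) ^ 2 = 0 := by
      linear_combination hcon t + Real.sin_sq_add_cos_sq (z₁ t) - 2 * hconst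
        - 2 * Real.sin_sq_add_cos_sq (z₁ 0)
    have hu : z₃ t - Real.sin (z₁ t) = 0 := by
      apply pow_eq_zero_iff two_ne_zero |>.mp
      nlinarith [sq_nonneg (z₃ t - Real.sin (z₁ t)), sq_nonneg (1 + z₄ t - Real.cos (z₁ t))]
    have hv : 1 + z₄ t - Real.cos (z₁ t) = 0 := by
      apply pow_eq_zero_iff two_ne_zero |>.mp
      nlinarith [sq_nonneg (z₃ t - Real.sin (z₁ t)), sq_nonneg (1 + z₄ t - Real.cos (z₁ t))]
    constructor <;> linarith
  refine ⟨haux, fun t => ?_⟩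
  rw [← (haux t).1]
  exact h2 t
end
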